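/- arXiv:2212.13226 — 5 statements merged into one kernel-verified Lean document; each statement's English description precedes it below -/
import Mathlib

section
/- Let Et : 𝒟 → ℰ and Es : 𝒟 → ℰ be pre-specified effective treatment functions, and suppose the true effective treatment function Et* : 𝒟 → ℰ* is correct (Et* d = Et* d' implies Y d = Y d' pointwise) and is coarser than Et, i.e., there is a map c : ℰ → ℰ* with Et* = c ∘ Et. Fix e ≠ 0, let M = {ω : Et (D ω) = e ∧ Es (D ω) = 0} with P(M) > 0, and let d_e, d_0 ∈ 𝒟 satisfy Et* d_e = c e and Et* d_0 = 0. Then E[Yobs − Y d_0 ∣ M] = E[Y d_e − Y d_0 ∣ M]; that is, the ATEM equals the average effect E[Y*(c(e)) − Y*(0) ∣ M] of receiving the true effective treatment intensity c(e) for the pre-specified movers. (Theorem 1(ii).) -/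
open MeasureTheory

/-- Theorem 1(ii): when the true effective treatment `Et*` is correct and coarser than the
pre-specified `Et` (via `c`), the ATEM equals the average effect
`E[Y*(c(e)) − Y*(0) ∣ M]` for the pre-specified movers. -/
theorem atem_eq_ate_of_correct_specification
    {Ω : Type*} [MeasurableSpace Ω] (P : Measure Ω) [IsProbabilityMeasure P]
    {𝒟 : Type*} [Fintype 𝒟] [Nonempty 𝒟]
    {ℰ : Type*} [Zero ℰ] {ℰstar : Type*} [Zero ℰstar]
    (D : Ω → 𝒟) (hD : @Measurable Ω 𝒟 _ ⊤ D)
    (Y : 𝒟 → Ω → ℝ) (hY : ∀ d, Integrable (Y d) P)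
    (Et Es : 𝒟 → ℰ) (Etstar : 𝒟 → ℰstar)
    (hcorrect : ∀ d d', Etstar d = Etstar d' → Y d = Y d')
    (c : ℰ → ℰstar) (hcoarse : ∀ d, Etstar d = c (Et d))
    (e : ℰ) (he : e ≠ 0)
    (M : Set Ω) (hMdef : M = {ω | Et (D ω) = e ∧ Es (D ω) = 0})
    (hPM : 0 < P M)
    (de d0 : 𝒟) (hde : Etstar de = c e) (hd0 : Etstar d0 = 0) :
    (∫ ω in M, (Y (D ω) ω - Y d0 ω) ∂P) / (P M).toReal
      = (∫ ω in M, (Y de ω - Y d0 ω) ∂P) / (P M).toReal := by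
  have hM : MeasurableSet M := by
    subst hMdef
    exact hD (t := {d | Et d = e ∧ Es d = 0}) trivial
  congr 1
  refine setIntegral_congr_fun hM fun ω hω => ?_
  rw [hMdef] at hω
  have hY_eq : Y (D ω) = Y de := hcorrect _ _ (by rw [hcoarse, hω.1, hde])
  simp only [hY_eq]
end

section
/- Let Et, Es : 𝒟 → ℰ be pre-specified effective treatment functions and Et*, Es* : 𝒟 → ℰ* the true ones, with Et* correct (Et* d = Et* d' implies Y d = Y d' pointwise) and ℰ* finite. Assume that for all d ∈ 𝒟, Es d = 0 implies Es* d = 0. Fix e ≠ 0, let M = {ω : Et (D ω) = e ∧ Es (D ω) = 0} with P(M) > 0, and for e* ∈ ℰ* let M*_{e*} = {ω : Et* (D ω) = e* ∧ Es* (D ω) = 0}. Fix d_0 ∈ 𝒟 with Et* d_0 = 0 and, for each e* in the range of Et*, a path d_{e*} with Et* d_{e*} = e*. Then E[Yobs − Y d_0 ∣ M] = Σ_{e*} E[Y d_{e*} − Y d_0 ∣ M ∩ M*_{e*}] · P(M ∩ M*_{e*}) / P(M), where the sum runs over e* in the range of Et* with P(M ∩ M*_{e*}) > 0; moreover the weights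 P(M ∩ M*_{e*}) / P(M) are non-negative and sum to one. (Theorem 1(iii).) -/
open MeasureTheory
open scoped Classical

/-- The integral over a finite disjoint union is the sum over the pieces of positive measure, where
pieces known to be empty may be left out as well. -/
theorem setIntegral_iUnion_eq_sum_filter_pos
    {Ω ι : Type*} [MeasurableSpace Ω] [Fintype ι] {P : Measure Ω}
    {S : ι → Set Ω} (hS : ∀ i, MeasurableSet (S i))
    (hdisj : Pairwise (Function.onFun Disjoint S)) {p : ι → Prop}
    [DecidablePred fun i => p i ∧ 0 < P (S i)] (hp : ∀ i, ¬ p i → S i = ∅)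
    {f : Ω → ℝ} (hf : ∀ i, IntegrableOn f (S i) P) :
    ∫ ω in ⋃ i, S i, f ω ∂P
      = ∑ i ∈ Finset.univ.filter (fun i => p i ∧ 0 < P (S i)), ∫ ω in S i, f ω ∂P := by
  rw [integral_iUnion_fintype hS hdisj hf]
  refine (Finset.sum_filter_of_ne fun i _ hi => ⟨?_, ?_⟩).symm
  · by_contra h
    exact hi (by rw [hp i h, setIntegral_empty])
  · by_contra h
    exact hi (setIntegral_measure_zero f (by simpa using h))

/-- Theorem 1(iii): for a possibly incorrect pre-specified effective treatment, the ATEM is a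
non-negatively weighted average (weights summing to one) of ATEs conditional on being both a
true mover and a pre-specified mover. -/
theorem atem_weighted_average_of_incorrect_specification
    {Ω : Type*} [MeasurableSpace Ω] (P : Measure Ω) [IsProbabilityMeasure P]
    {𝒟 : Type*} [Fintype 𝒟] [Nonempty 𝒟]
    {ℰ : Type*} [Zero ℰ] {ℰstar : Type*} [Zero ℰstar] [Fintype ℰstar]
    (D : Ω → 𝒟) (hD : @Measurable Ω 𝒟 _ ⊤ D)
    (Y : 𝒟 → Ω → ℝ) (hY : ∀ d, Integrable (Y d) P)
    (Et Es : 𝒟 → ℰ) (Etstar Esstar : 𝒟 → ℰstar)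
    (hcorrect : ∀ d d', Etstar d = Etstar d' → Y d = Y d')
    (hzero : ∀ d, Es d = 0 → Esstar d = 0)
    (e : ℰ) (he : e ≠ 0)
    (M : Set Ω) (hMdef : M = {ω | Et (D ω) = e ∧ Es (D ω) = 0})
    (hPM : 0 < P M)
    (Mstar : ℰstar → Set Ω)
    (hMstardef : ∀ estar, Mstar estar = {ω | Etstar (D ω) = estar ∧ Esstar (D ω) = 0})
    (d0 : 𝒟) (hd0 : Etstar d0 = 0)
    (dsel : ℰstar → 𝒟) (hdsel : ∀ estar ∈ Set.range Etstar, Etstar (dsel estar) = estar) :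
    ((∫ ω in M, (Y (D ω) ω - Y d0 ω) ∂P) / (P M).toReal
        = ∑ estar ∈ Finset.univ.filter
            (fun estar => estar ∈ Set.range Etstar ∧ 0 < P (M ∩ Mstar estar)),
            ((∫ ω in M ∩ Mstar estar, (Y (dsel estar) ω - Y d0 ω) ∂P)
                / (P (M ∩ Mstar estar)).toReal)
              * ((P (M ∩ Mstar estar)).toReal / (P M).toReal))
    ∧ (∀ estar, 0 ≤ (P (M ∩ Mstar estar)).toReal / (P M).toReal)
    ∧ (∑ estar ∈ Finset.univ.filter
          (fun estar => estar ∈ Set.range Etstar ∧ 0 < P (M ∩ Mstar estar)),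
          (P (M ∩ Mstar estar)).toReal / (P M).toReal) = 1 := by
  have hmeas : ∀ s : Set 𝒟, MeasurableSet (D ⁻¹' s) := fun _ => hD MeasurableSpace.measurableSet_top
  have hS : ∀ i, MeasurableSet (M ∩ Mstar i) := by
    intro i
    rw [hMdef, hMstardef]
    exact (hmeas {d | Et d = e ∧ Es d = 0}).inter (hmeas {d | Etstar d = i ∧ Esstar d = 0})
  have hmem : ∀ i, ∀ ω ∈ M ∩ Mstar i, Etstar (D ω) = i := by
    intro i ω hω
    have h := hω.2
    rw [hMstardef] at h
    exact h.1
  have hdisj : Pairwise (Function.onFun Disjoint fun i => M ∩ Mstar i) := fun i j hij =>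
    Set.disjoint_left.2 fun ω hi hj => hij ((hmem i ω hi).symm.trans (hmem j ω hj))
  have hM : M = ⋃ i, M ∩ Mstar i := by
    rw [← Set.inter_iUnion, eq_comm, Set.inter_eq_left]
    intro ω hω
    rw [hMdef] at hω
    refine Set.mem_iUnion.2 ⟨Etstar (D ω), ?_⟩
    rw [hMstardef]
    exact ⟨rfl, hzero _ hω.2⟩
  have hp : ∀ i, i ∉ Set.range Etstar → M ∩ Mstar i = ∅ := fun i hi =>
    Set.eq_empty_of_forall_notMem fun ω hω => hi ⟨D ω, hmem i ω hω⟩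
  have heq : ∀ i, Set.EqOn (fun ω => Y (D ω) ω - Y d0 ω) (fun ω => Y (dsel i) ω - Y d0 ω)
      (M ∩ Mstar i) := by
    intro i ω hω
    have h := hmem i ω hω
    have hY' : Y (D ω) = Y (dsel i) := hcorrect _ _ (h.trans (hdsel i ⟨D ω, h⟩).symm)
    simp only [hY']
  have hint : ∀ i, IntegrableOn (fun ω => Y (D ω) ω - Y d0 ω) (M ∩ Mstar i) P := fun i =>
    (integrableOn_congr_fun (heq i) (hS i)).2 ((hY _).sub (hY _)).integrableOn
  have hM0 : (P M).toReal ≠ 0 := (ENNReal.toReal_pos hPM.ne' (measure_ne_top P M)).ne'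
  refine ⟨?_, fun i => by positivity, ?_⟩
  · have hout := congrArg (· / (P M).toReal)
      (setIntegral_iUnion_eq_sum_filter_pos hS hdisj hp hint)
    simp only [← hM, Finset.sum_div] at hout
    refine hout.trans ?_
    refine Finset.sum_congr (by congr!) fun i hi => ?_
    have hi0 : (P (M ∩ Mstar i)).toReal ≠ 0 :=
      (ENNReal.toReal_pos (Finset.mem_filter.1 hi).2.2.ne' (measure_ne_top P _)).ne'
    rw [setIntegral_congr_fun (hS i) (heq i), div_mul_div_cancel₀ hi0]
  · have hone := setIntegral_iUnion_eq_sum_filter_pos (P := P) hS hdisj hp (f := fun _ => (1 : ℝ))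
      fun i => (integrable_const _).integrableOn
    simp only [← hM, setIntegral_const, smul_eq_mul, mul_one, Measure.real] at hone
    rw [← Finset.sum_div, div_eq_one_iff_eq hM0, hone]
end

section
/- (Identification of the ATEM in the absence of covariates.) Let (Ω, 𝔉, P) be a probability space, s < t natural numbers, Y⁰_r : Ω → ℝ integrable for each r with s ≤ r ≤ t (untreated potential outcomes), and Yobs_t, Yobs_s : Ω → ℝ integrable observed outcomes. Let 𝒢 ⊆ 𝔉 be a sub-σ-algebra and M, S ∈ 𝒢 disjoint events with P(M) > 0 and P(S) > 0. Assume: (i) for each r with s < r ≤ t, E[Y⁰_r − Y⁰_{r−1} ∣ 𝒢] = E[Y⁰_r − Y⁰_{r−1}] P-a.s. (unconditional parallel trends); (ii) Yobs_s = Y⁰_s almost everywhere on M ∪ S; (iii) Yobs_t = Y⁰_t almost everywhere on S. Then E[Yobs_t − Y⁰_t ∣ M] = E[Yobs_t − Yobs_s ∣ M] − E[Yobs_t − Yobs_s ∣ S]. -/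
open MeasureTheory

/-- If the conditional expectation of `f` is almost surely its mean, then the integral of `f` over
an event of the conditioning σ-algebra is the mean of `f` scaled by the measure of the event. -/
theorem setIntegral_eq_of_condExp_ae_eq_const {Ω : Type*} {m m₀ : MeasurableSpace Ω}
    {P : Measure Ω} [IsFiniteMeasure P] (hm : m ≤ m₀) {f : Ω → ℝ} (hf : Integrable f P)
    (hc : P[f | m] =ᵐ[P] fun _ => ∫ ω, f ω ∂P) {A : Set Ω} (hA : MeasurableSet[m] A) :
    ∫ ω in A, f ω ∂P = (P A).toReal * ∫ ω, f ω ∂P := by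
  rw [← setIntegral_condExp hm hf hA, integral_congr_ae (ae_restrict_of_ae hc),
    setIntegral_const, smul_eq_mul, measureReal_def]

/-- Parallel trends for the one-period increments of `Y` gives parallel trends for the increment
of `Y` from `s` to `t`. -/
theorem setIntegral_sub_eq_of_condExp_increments {Ω : Type*} {m m₀ : MeasurableSpace Ω}
    {P : Measure Ω} [IsFiniteMeasure P] (hm : m ≤ m₀) {s t : ℕ} (hst : s ≤ t) {Y : ℕ → Ω → ℝ}
    (hY : ∀ r, s ≤ r → r ≤ t → Integrable (Y r) P)
    (hpt : ∀ r, s < r → r ≤ t →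
      P[fun ω => Y r ω - Y (r - 1) ω | m] =ᵐ[P] fun _ => ∫ ω, (Y r ω - Y (r - 1) ω) ∂P)
    {A : Set Ω} (hA : MeasurableSet[m] A) :
    ∫ ω in A, (Y t ω - Y s ω) ∂P = (P A).toReal * ∫ ω, (Y t ω - Y s ω) ∂P := by
  induction t, hst using Nat.le_induction with
  | base => simp
  | succ n hn ih =>
    have ih' := ih (fun r h₁ h₂ => hY r h₁ (by omega)) (fun r h₁ h₂ => hpt r h₁ (by omega))
    have hYs := hY s le_rfl (by omega)
    have hYn := hY n hn (by omega)
    have hYn' := hY (n + 1) (by omega) le_rfl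
    have hstep := setIntegral_eq_of_condExp_ae_eq_const hm (hYn'.sub hYn)
      (hpt (n + 1) (by omega) le_rfl) hA
    simp only [Pi.sub_apply] at hstep
    rw [integral_sub hYn' hYn, integral_sub hYn'.integrableOn hYn.integrableOn] at hstep
    rw [integral_sub hYn hYs, integral_sub hYn.integrableOn hYs.integrableOn] at ih'
    rw [integral_sub hYn' hYs, integral_sub hYn'.integrableOn hYs.integrableOn]
    linear_combination hstep + ih'

/-- Identification of the ATEM in the absence of covariates:
`E[Yobs_t − Y⁰_t ∣ M] = E[Yobs_t − Yobs_s ∣ M] − E[Yobs_t − Yobs_s ∣ S]`. -/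
theorem atem_identification_no_covariates
    {Ω : Type*} {𝔉 : MeasurableSpace Ω} (P : Measure Ω) [IsProbabilityMeasure P]
    (s t : ℕ) (hst : s < t)
    (Y0 : ℕ → Ω → ℝ) (hY0 : ∀ r, s ≤ r → r ≤ t → Integrable (Y0 r) P)
    (Yobs_t Yobs_s : Ω → ℝ) (hYt : Integrable Yobs_t P) (hYs : Integrable Yobs_s P)
    (𝒢 : MeasurableSpace Ω) (h𝒢 : 𝒢 ≤ 𝔉)
    (M S : Set Ω) (hM : MeasurableSet[𝒢] M) (hS : MeasurableSet[𝒢] S)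
    (hMS : Disjoint M S) (hPM : 0 < P M) (hPS : 0 < P S)
    (hpt : ∀ r, s < r → r ≤ t →
      P[fun ω => Y0 r ω - Y0 (r - 1) ω | 𝒢]
        =ᵐ[P] fun _ => ∫ ω, (Y0 r ω - Y0 (r - 1) ω) ∂P)
    (hcons_s : ∀ᵐ ω ∂P, ω ∈ M ∪ S → Yobs_s ω = Y0 s ω)
    (hcons_t : ∀ᵐ ω ∂P, ω ∈ S → Yobs_t ω = Y0 t ω) :
    (∫ ω in M, (Yobs_t ω - Y0 t ω) ∂P) / (P M).toReal
      = (∫ ω in M, (Yobs_t ω - Yobs_s ω) ∂P) / (P M).toReal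
        - (∫ ω in S, (Yobs_t ω - Yobs_s ω) ∂P) / (P S).toReal := by
  have hY0s := hY0 s le_rfl hst.le
  have hY0t := hY0 t hst.le le_rfl
  have hTM := setIntegral_sub_eq_of_condExp_increments h𝒢 hst.le hY0 hpt hM
  have hTS := setIntegral_sub_eq_of_condExp_increments h𝒢 hst.le hY0 hpt hS
  have hobsS : ∫ ω in S, (Yobs_t ω - Yobs_s ω) ∂P = ∫ ω in S, (Y0 t ω - Y0 s ω) ∂P := by
    refine setIntegral_congr_ae (h𝒢 S hS) ?_
    filter_upwards [hcons_s, hcons_t] with ω h₁ h₂ hω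
    rw [h₁ (Or.inr hω), h₂ hω]
  have hobsM : ∫ ω in M, Yobs_s ω ∂P = ∫ ω in M, Y0 s ω ∂P := by
    refine setIntegral_congr_ae (h𝒢 M hM) ?_
    filter_upwards [hcons_s] with ω h₁ hω
    exact h₁ (Or.inl hω)
  have hM₀ : (P M).toReal ≠ 0 := (ENNReal.toReal_pos hPM.ne' (measure_ne_top P M)).ne'
  have hS₀ : (P S).toReal ≠ 0 := (ENNReal.toReal_pos hPS.ne' (measure_ne_top P S)).ne'
  rw [hobsS, hTS, mul_div_cancel_left₀ _ hS₀, eq_sub_iff_add_eq, div_add' _ _ _ hM₀, mul_comm,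
    ← hTM, integral_sub hYt.integrableOn hY0t.integrableOn,
    integral_sub hYt.integrableOn hYs.integrableOn,
    integral_sub hY0t.integrableOn hY0s.integrableOn, hobsM]
  ring
end

section
/- (Theorem 2, outcome-regression identification.) Under the DiD identification setup, the ATEM is identified by the OR estimand: E[Yobs_t − Y⁰_t ∣ M] = E[(1_M / P(M)) · (ΔY − m)]. -/
open MeasureTheory

/-- The generalized propensity score `p = E[1_M ∣ ℋ] / (E[1_M ∣ ℋ] + E[1_S ∣ ℋ])`. -/
noncomputable def gps {Ω : Type*} {𝔉 : MeasurableSpace Ω} (P : Measure Ω)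
    (ℋ : MeasurableSpace Ω) (M S : Set Ω) : Ω → ℝ := fun ω =>
  (P[M.indicator (fun _ => (1 : ℝ)) | ℋ]) ω /
    ((P[M.indicator (fun _ => (1 : ℝ)) | ℋ]) ω + (P[S.indicator (fun _ => (1 : ℝ)) | ℋ]) ω)

/-- The odds ratio `r = p / (1 − p)` of the generalized propensity score. -/
noncomputable def gpsOdds {Ω : Type*} {𝔉 : MeasurableSpace Ω} (P : Measure Ω)
    (ℋ : MeasurableSpace Ω) (M S : Set Ω) : Ω → ℝ := fun ω =>
  gps P ℋ M S ω / (1 - gps P ℋ M S ω)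

/-- If the conditional expectations given `m₁` and `m₂` of every one-step increment agree, then so
do those of the cumulative increment. -/
theorem condExp_sub_ae_eq_of_increments {Ω : Type*} {𝔉 : MeasurableSpace Ω} {P : Measure Ω}
    {m₁ m₂ : MeasurableSpace Ω} {Y : ℕ → Ω → ℝ} {s t : ℕ} (hst : s ≤ t)
    (hY : ∀ r, s ≤ r → r ≤ t → Integrable (Y r) P)
    (h : ∀ r, s < r → r ≤ t →
      P[fun ω => Y r ω - Y (r - 1) ω | m₁] =ᵐ[P] P[fun ω => Y r ω - Y (r - 1) ω | m₂]) :
    P[Y t - Y s | m₁] =ᵐ[P] P[Y t - Y s | m₂] := by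
  induction t, hst using Nat.le_induction with
  | base => simp
  | succ n hn ih =>
    have ih' := ih (fun r h₁ h₂ => hY r h₁ (by lia)) (fun r h₁ h₂ => h r h₁ (by lia))
    have hstep : P[Y (n + 1) - Y n | m₁] =ᵐ[P] P[Y (n + 1) - Y n | m₂] :=
      h (n + 1) (by lia) le_rfl
    have hint₁ : Integrable (Y (n + 1) - Y n) P :=
      (hY _ (by lia) le_rfl).sub (hY _ hn (by lia))
    have hint₂ : Integrable (Y n - Y s) P := (hY _ hn (by lia)).sub (hY _ le_rfl (by lia))
    rw [← sub_add_sub_cancel (Y (n + 1)) (Y n) (Y s)]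
    exact (condExp_add hint₁ hint₂ m₁).trans
      ((hstep.add ih').trans (condExp_add hint₁ hint₂ m₂).symm)

/-- If conditioning on a finer σ-algebra `𝒢` does not change `E[W ∣ ℋ]`, then `W` and the
indicator of a `𝒢`-measurable event are conditionally uncorrelated given `ℋ`. -/
theorem condExp_indicator_ae_eq_mul {Ω : Type*} {𝔉 : MeasurableSpace Ω} {P : Measure Ω}
    [IsFiniteMeasure P] {ℋ 𝒢 : MeasurableSpace Ω} (hℋ𝒢 : ℋ ≤ 𝒢) (h𝒢 : 𝒢 ≤ 𝔉) {W : Ω → ℝ}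
    (hW : Integrable W P) (hcond : P[W | 𝒢] =ᵐ[P] P[W | ℋ]) {S : Set Ω}
    (hS : MeasurableSet[𝒢] S) :
    P[S.indicator W | ℋ] =ᵐ[P] P[W | ℋ] * P[S.indicator (fun _ => (1 : ℝ)) | ℋ] := by
  have hmul : S.indicator (P[W | ℋ]) = P[W | ℋ] * S.indicator (fun _ => (1 : ℝ)) := by
    ext ω
    by_cases hω : ω ∈ S <;> simp [hω]
  have hinner : P[S.indicator W | 𝒢] =ᵐ[P] P[W | ℋ] * S.indicator (fun _ => (1 : ℝ)) := by
    rw [← hmul]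
    filter_upwards [condExp_indicator hW hS, hcond] with ω h₁ h₂
    rw [h₁]
    by_cases hω : ω ∈ S <;> simp [hω, h₂]
  refine (condExp_condExp_of_le hℋ𝒢 h𝒢).symm.trans ((condExp_congr_ae hinner).trans ?_)
  refine condExp_mul_of_stronglyMeasurable_left stronglyMeasurable_condExp ?_
    ((integrable_const (1 : ℝ)).indicator (h𝒢 S hS))
  rw [← hmul]
  exact integrable_condExp.indicator (h𝒢 S hS)

/-- Theorem 2 (outcome-regression identification): under consistency, conditional parallel
trends, and overlap, the ATEM is identified by the OR estimand
`E[Yobs_t − Y⁰_t ∣ M] = E[(1_M / P(M)) · (ΔY − m)]`. -/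
theorem atem_or_identification
    {Ω : Type*} {𝔉 : MeasurableSpace Ω} (P : Measure Ω) [IsProbabilityMeasure P]
    (s t : ℕ) (hst : s < t)
    (Y0 : ℕ → Ω → ℝ) (hY0int : ∀ r, s ≤ r → r ≤ t → Integrable (Y0 r) P)
    (Yobs_t Yobs_s : Ω → ℝ) (hYt : Integrable Yobs_t P) (hYs : Integrable Yobs_s P)
    (ℋ 𝒟σ : MeasurableSpace Ω) (hℋ : ℋ ≤ 𝔉) (h𝒟 : 𝒟σ ≤ 𝔉)
    (M S : Set Ω) (hM : MeasurableSet[𝒟σ] M) (hS : MeasurableSet[𝒟σ] S)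
    (hMS : Disjoint M S) (hPM : 0 < P M)
    (hcons_s : ∀ᵐ ω ∂P, ω ∈ M ∪ S → Yobs_s ω = Y0 s ω)
    (hcons_t : ∀ᵐ ω ∂P, ω ∈ S → Yobs_t ω = Y0 t ω)
    (hpt : ∀ r, s < r → r ≤ t →
      P[fun ω => Y0 r ω - Y0 (r - 1) ω | 𝒟σ ⊔ ℋ]
        =ᵐ[P] P[fun ω => Y0 r ω - Y0 (r - 1) ω | ℋ])
    (ε : ℝ) (hε : 0 < ε)
    (hoverS : ∀ᵐ ω ∂P, ε ≤ (P[S.indicator (fun _ => (1 : ℝ)) | ℋ]) ω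
        ∧ (P[S.indicator (fun _ => (1 : ℝ)) | ℋ]) ω ≤ 1 - ε)
    (hoverp : ∀ᵐ ω ∂P, ε ≤ gps P ℋ M S ω ∧ gps P ℋ M S ω ≤ 1 - ε)
    (m : Ω → ℝ) (hm_meas : Measurable[ℋ] m) (hm_int : Integrable m P)
    (hm : (fun ω => m ω * (P[S.indicator (fun _ => (1 : ℝ)) | ℋ]) ω)
        =ᵐ[P] P[fun ω => S.indicator (fun _ => (1 : ℝ)) ω * (Yobs_t ω - Yobs_s ω) | ℋ]) :
    (∫ ω in M, (Yobs_t ω - Y0 t ω) ∂P) / (P M).toReal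
      = ∫ ω, (M.indicator (fun _ => (1 : ℝ)) ω / (P M).toReal)
          * ((Yobs_t ω - Yobs_s ω) - m ω) ∂P := by
  have h𝒢 : 𝒟σ ⊔ ℋ ≤ 𝔉 := sup_le h𝒟 hℋ
  have hM𝒢 : MeasurableSet[𝒟σ ⊔ ℋ] M := (le_sup_left : 𝒟σ ≤ 𝒟σ ⊔ ℋ) M hM
  have hS𝒢 : MeasurableSet[𝒟σ ⊔ ℋ] S := (le_sup_left : 𝒟σ ≤ 𝒟σ ⊔ ℋ) S hS
  have hM𝔉 := h𝒟 M hM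
  have hW : Integrable (Y0 t - Y0 s) P := (hY0int t hst.le le_rfl).sub (hY0int s le_rfl hst.le)
  have hcond := condExp_sub_ae_eq_of_increments hst.le hY0int hpt
  have hstayers : (fun ω => S.indicator (fun _ => (1 : ℝ)) ω * (Yobs_t ω - Yobs_s ω))
      =ᵐ[P] S.indicator (Y0 t - Y0 s) := by
    filter_upwards [hcons_s, hcons_t] with ω h₁ h₂
    by_cases hω : ω ∈ S
    · simp [hω, h₁ (Or.inr hω), h₂ hω]
    · simp [hω]
  have hm_eq : m =ᵐ[P] P[Y0 t - Y0 s | ℋ] := by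
    filter_upwards [hm, condExp_congr_ae hstayers,
      condExp_indicator_ae_eq_mul le_sup_right h𝒢 hW hcond hS𝒢, hoverS] with ω h₁ h₂ h₃ h₄
    exact mul_right_cancel₀ (hε.trans_le h₄.1).ne' (h₁.trans (h₂.trans h₃))
  have hint_m : ∫ ω in M, m ω ∂P = ∫ ω in M, (Y0 t - Y0 s) ω ∂P :=
    (setIntegral_congr_ae hM𝔉 ((hm_eq.trans hcond.symm).mono fun _ h _ => h)).trans
      (setIntegral_condExp h𝒢 hW hM𝒢)
  have hmovers : ∫ ω in M, (Yobs_t ω - Y0 t ω) ∂P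
      = ∫ ω in M, ((Yobs_t ω - Yobs_s ω) - (Y0 t - Y0 s) ω) ∂P := by
    refine setIntegral_congr_ae hM𝔉 ?_
    filter_upwards [hcons_s] with ω h hω
    simp [h (Or.inl hω)]
  have hΔ : Integrable (fun ω => Yobs_t ω - Yobs_s ω) P := hYt.sub hYs
  have hweight : ∀ ω, (M.indicator (fun _ => (1 : ℝ)) ω / (P M).toReal)
      * ((Yobs_t ω - Yobs_s ω) - m ω)
      = M.indicator (fun ω => (Yobs_t ω - Yobs_s ω) - m ω) ω / (P M).toReal := by
    intro ω
    by_cases hω : ω ∈ M <;> simp [hω, div_eq_inv_mul]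
  simp_rw [hweight]
  rw [integral_div, integral_indicator hM𝔉, hmovers,
    integral_sub hΔ.integrableOn hW.integrableOn, integral_sub hΔ.integrableOn hm_int.integrableOn,
    hint_m]
end

section
/- (Theorem 2, doubly robust identification.) Under the DiD identification setup, the ATEM is identified by the DR estimand: E[Yobs_t − Y⁰_t ∣ M] = E[(1_M / P(M) − r · 1_S / E[r · 1_S]) · (ΔY − m)]. -/
open MeasureTheory

/-- Parallel trends over consecutive periods add up to parallel trends over a longer horizon. -/
theorem condExp_sub_ae_eq_of_consecutive {Ω : Type*} {𝔉 : MeasurableSpace Ω} {P : Measure Ω}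
    {s t : ℕ} {Y : ℕ → Ω → ℝ} (hY : ∀ r, s ≤ r → r ≤ t → Integrable (Y r) P)
    {𝒢 ℋ : MeasurableSpace Ω}
    (h : ∀ r, s < r → r ≤ t →
      P[fun ω => Y r ω - Y (r - 1) ω | 𝒢] =ᵐ[P] P[fun ω => Y r ω - Y (r - 1) ω | ℋ])
    {n : ℕ} (hsn : s ≤ n) (hnt : n ≤ t) :
    P[Y n - Y s | 𝒢] =ᵐ[P] P[Y n - Y s | ℋ] := by
  induction n, hsn using Nat.le_induction with
  | base => simp
  | succ n hsn ih =>
    have hstep := h (n + 1) (by omega) hnt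
    have hsplit : Y (n + 1) - Y s =
        (fun ω => Y (n + 1) ω - Y (n + 1 - 1) ω) + (Y n - Y s) := by
      ext ω
      simp
    have hint₁ : Integrable (fun ω => Y (n + 1) ω - Y (n + 1 - 1) ω) P :=
      (hY _ (by omega) hnt).sub (hY _ (by omega) (by omega))
    have hint₂ : Integrable (Y n - Y s) P :=
      (hY _ hsn (by omega)).sub (hY _ le_rfl (by omega))
    rw [hsplit]
    exact (condExp_add hint₁ hint₂ 𝒢).trans
      ((hstep.add (ih (by omega))).trans (condExp_add hint₁ hint₂ ℋ).symm)

/-- A bounded `𝒢`-measurable function is orthogonal to the residual `g - E[g ∣ 𝒢]`. -/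
theorem integral_mul_sub_condExp_eq_zero {Ω : Type*} {𝔉 : MeasurableSpace Ω} {P : Measure Ω}
    [IsFiniteMeasure P] {𝒢 : MeasurableSpace Ω} (h𝒢 : 𝒢 ≤ 𝔉) {f g : Ω → ℝ}
    (hf : StronglyMeasurable[𝒢] f) {c : ℝ} (hc : ∀ᵐ ω ∂P, ‖f ω‖ ≤ c) (hg : Integrable g P) :
    ∫ ω, f ω * (g ω - (P[g | 𝒢]) ω) ∂P = 0 := by
  have hf' : AEStronglyMeasurable[𝔉] f P := (hf.mono h𝒢).aestronglyMeasurable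
  have hpull : ∫ ω, f ω * g ω ∂P = ∫ ω, f ω * (P[g | 𝒢]) ω ∂P := by
    rw [← integral_condExp h𝒢]
    exact integral_congr_ae (condExp_stronglyMeasurable_mul_of_bound h𝒢 hf hg c hc)
  simp_rw [mul_sub]
  rw [integral_sub (hg.bdd_mul hf' hc) (integrable_condExp.bdd_mul hf' hc), hpull, sub_self]

/-- If conditioning `g` on the finer `𝒢` or on `ℋ` gives the same result, then `g` and a bounded
`𝒢`-measurable function are conditionally uncorrelated given `ℋ`. -/
theorem condExp_mul_ae_eq_of_condExp_ae_eq {Ω : Type*} {𝔉 : MeasurableSpace Ω} {P : Measure Ω}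
    [IsFiniteMeasure P] {𝒢 ℋ : MeasurableSpace Ω} (hℋ𝒢 : ℋ ≤ 𝒢) (h𝒢 : 𝒢 ≤ 𝔉) {f g : Ω → ℝ}
    (hf : StronglyMeasurable[𝒢] f) {c : ℝ} (hc : ∀ᵐ ω ∂P, ‖f ω‖ ≤ c) (hg : Integrable g P)
    (h : P[g | 𝒢] =ᵐ[P] P[g | ℋ]) :
    P[f * g | ℋ] =ᵐ[P] P[f | ℋ] * P[g | ℋ] := by
  have hf' : AEStronglyMeasurable[𝔉] f P := (hf.mono h𝒢).aestronglyMeasurable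
  calc P[f * g | ℋ] =ᵐ[P] P[P[f * g | 𝒢] | ℋ] := (condExp_condExp_of_le hℋ𝒢 h𝒢).symm
    _ =ᵐ[P] P[f * P[g | ℋ] | ℋ] := condExp_congr_ae <|
      (condExp_stronglyMeasurable_mul_of_bound h𝒢 hf hg c hc).trans
        (Filter.EventuallyEq.rfl.mul h)
    _ =ᵐ[P] P[f | ℋ] * P[g | ℋ] :=
      condExp_mul_of_stronglyMeasurable_right stronglyMeasurable_condExp
        (integrable_condExp.bdd_mul hf' hc) (.of_bound hf' c hc)

/-- The odds ratio of the propensity score is `ℋ`-measurable. -/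
theorem stronglyMeasurable_gpsOdds {Ω : Type*} {𝔉 : MeasurableSpace Ω} (P : Measure Ω)
    (ℋ : MeasurableSpace Ω) (M S : Set Ω) : StronglyMeasurable[ℋ] (gpsOdds P ℋ M S) := by
  have hM : Measurable[ℋ] (P[M.indicator (fun _ => (1 : ℝ)) | ℋ]) :=
    stronglyMeasurable_condExp.measurable
  have hS : Measurable[ℋ] (P[S.indicator (fun _ => (1 : ℝ)) | ℋ]) :=
    stronglyMeasurable_condExp.measurable
  have hp : Measurable[ℋ] (gps P ℋ M S) := hM.div (hM.add hS)
  exact (hp.div (measurable_const.sub hp)).stronglyMeasurable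

/-- Under overlap the odds ratio of the propensity score is bounded. -/
theorem norm_gpsOdds_le {Ω : Type*} {𝔉 : MeasurableSpace Ω} {P : Measure Ω}
    {ℋ : MeasurableSpace Ω} {M S : Set Ω} {ε : ℝ} (hε : 0 < ε) {ω : Ω}
    (h₁ : ε ≤ gps P ℋ M S ω) (h₂ : gps P ℋ M S ω ≤ 1 - ε) : ‖gpsOdds P ℋ M S ω‖ ≤ 1 / ε := by
  have hp : 0 ≤ gps P ℋ M S ω := hε.le.trans h₁
  have hq : ε ≤ 1 - gps P ℋ M S ω := by linarith
  rw [gpsOdds, Real.norm_of_nonneg (div_nonneg hp (hε.le.trans hq))]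
  exact div_le_div₀ zero_le_one (by linarith) hε hq

/-- The indicator of an event is bounded by one. -/
theorem norm_indicator_one_le {Ω : Type*} (A : Set Ω) (ω : Ω) :
    ‖A.indicator (fun _ => (1 : ℝ)) ω‖ ≤ 1 :=
  (norm_indicator_le_norm_self _ _).trans (by simp)

/-- Theorem 2 (doubly robust identification): the ATEM is identified by the DR estimand
`E[Yobs_t − Y⁰_t ∣ M] = E[(1_M / P(M) − r·1_S / E[r·1_S]) · (ΔY − m)]`. -/
theorem atem_dr_identification
    {Ω : Type*} {𝔉 : MeasurableSpace Ω} (P : Measure Ω) [IsProbabilityMeasure P]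
    (s t : ℕ) (hst : s < t)
    (Y0 : ℕ → Ω → ℝ) (hY0int : ∀ r, s ≤ r → r ≤ t → Integrable (Y0 r) P)
    (Yobs_t Yobs_s : Ω → ℝ) (hYt : Integrable Yobs_t P) (hYs : Integrable Yobs_s P)
    (ℋ 𝒟σ : MeasurableSpace Ω) (hℋ : ℋ ≤ 𝔉) (h𝒟 : 𝒟σ ≤ 𝔉)
    (M S : Set Ω) (hM : MeasurableSet[𝒟σ] M) (hS : MeasurableSet[𝒟σ] S)
    (hMS : Disjoint M S) (hPM : 0 < P M)
    (hcons_s : ∀ᵐ ω ∂P, ω ∈ M ∪ S → Yobs_s ω = Y0 s ω)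
    (hcons_t : ∀ᵐ ω ∂P, ω ∈ S → Yobs_t ω = Y0 t ω)
    (hpt : ∀ r, s < r → r ≤ t →
      P[fun ω => Y0 r ω - Y0 (r - 1) ω | 𝒟σ ⊔ ℋ]
        =ᵐ[P] P[fun ω => Y0 r ω - Y0 (r - 1) ω | ℋ])
    (ε : ℝ) (hε : 0 < ε)
    (hoverS : ∀ᵐ ω ∂P, ε ≤ (P[S.indicator (fun _ => (1 : ℝ)) | ℋ]) ω
        ∧ (P[S.indicator (fun _ => (1 : ℝ)) | ℋ]) ω ≤ 1 - ε)
    (hoverp : ∀ᵐ ω ∂P, ε ≤ gps P ℋ M S ω ∧ gps P ℋ M S ω ≤ 1 - ε)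
    (m : Ω → ℝ) (hm_meas : Measurable[ℋ] m) (hm_int : Integrable m P)
    (hm : (fun ω => m ω * (P[S.indicator (fun _ => (1 : ℝ)) | ℋ]) ω)
        =ᵐ[P] P[fun ω => S.indicator (fun _ => (1 : ℝ)) ω * (Yobs_t ω - Yobs_s ω) | ℋ]) :
    (∫ ω in M, (Yobs_t ω - Y0 t ω) ∂P) / (P M).toReal
      = ∫ ω, (M.indicator (fun _ => (1 : ℝ)) ω / (P M).toReal
          - gpsOdds P ℋ M S ω * S.indicator (fun _ => (1 : ℝ)) ω
              / (∫ ω', gpsOdds P ℋ M S ω' * S.indicator (fun _ => (1 : ℝ)) ω' ∂P))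
          * ((Yobs_t ω - Yobs_s ω) - m ω) ∂P := by
  have hℋ𝒢 : ℋ ≤ 𝒟σ ⊔ ℋ := le_sup_right
  have h𝒢 : 𝒟σ ⊔ ℋ ≤ 𝔉 := sup_le h𝒟 hℋ
  have hYtint := hY0int t hst.le le_rfl
  have hΔint : Integrable (Y0 t - Y0 s) P := hYtint.sub (hY0int s le_rfl hst.le)
  have htrend : P[Y0 t - Y0 s | 𝒟σ ⊔ ℋ] =ᵐ[P] P[Y0 t - Y0 s | ℋ] :=
    condExp_sub_ae_eq_of_consecutive hY0int hpt hst.le le_rfl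
  have hind : ∀ {A : Set Ω}, MeasurableSet[𝒟σ] A →
      StronglyMeasurable[𝒟σ ⊔ ℋ] (A.indicator (fun _ => (1 : ℝ))) := fun hA =>
    stronglyMeasurable_const.indicator ((le_sup_left : 𝒟σ ≤ 𝒟σ ⊔ ℋ) _ hA)
  have hbdd : ∀ A : Set Ω, ∀ᵐ ω ∂P, ‖A.indicator (fun _ => (1 : ℝ)) ω‖ ≤ 1 := fun A =>
    .of_forall (norm_indicator_one_le A)
  have hstayers : (fun ω => S.indicator (fun _ => (1 : ℝ)) ω * (Yobs_t ω - Yobs_s ω))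
      =ᵐ[P] S.indicator (fun _ => (1 : ℝ)) * (Y0 t - Y0 s) := by
    filter_upwards [hcons_s, hcons_t] with ω h₁ h₂
    by_cases hω : ω ∈ S
    · simp [hω, h₁ (Or.inr hω), h₂ hω]
    · simp [hω]
  have hm_eq : P[Y0 t - Y0 s | 𝒟σ ⊔ ℋ] =ᵐ[P] m := by
    filter_upwards [htrend, hm, condExp_congr_ae (m := ℋ) hstayers, hoverS,
      condExp_mul_ae_eq_of_condExp_ae_eq hℋ𝒢 h𝒢 (hind hS) (hbdd S) hΔint htrend]
      with ω h₁ h₂ h₃ h₄ h₅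
    have hpos := (hε.trans_le h₄.1).ne'
    rw [h₁]
    apply mul_right_cancel₀ hpos
    rw [h₂, h₃, h₅, Pi.mul_apply, mul_comm]
  have hresid : ∀ {f : Ω → ℝ} {c : ℝ}, StronglyMeasurable[𝒟σ ⊔ ℋ] f → (∀ᵐ ω ∂P, ‖f ω‖ ≤ c) →
      ∫ ω, f ω * ((Y0 t - Y0 s) ω - m ω) ∂P = 0 := by
    intro f c hf hc
    rw [← integral_mul_sub_condExp_eq_zero h𝒢 hf hc hΔint]
    apply integral_congr_ae
    filter_upwards [hm_eq] with ω hω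
    rw [hω]
  have hweight : StronglyMeasurable[𝒟σ ⊔ ℋ]
      (fun ω => gpsOdds P ℋ M S ω * S.indicator (fun _ => (1 : ℝ)) ω) :=
    ((stronglyMeasurable_gpsOdds P ℋ M S).mono hℋ𝒢).mul (hind hS)
  have hweight_bdd : ∀ᵐ ω ∂P,
      ‖gpsOdds P ℋ M S ω * S.indicator (fun _ => (1 : ℝ)) ω‖ ≤ 1 / ε := by
    filter_upwards [hoverp] with ω hω
    rw [norm_mul]
    exact (mul_le_of_le_one_right (norm_nonneg _) (norm_indicator_one_le S ω)).trans
      (norm_gpsOdds_le hε hω.1 hω.2)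
  have hres_int : Integrable (fun ω => (Y0 t - Y0 s) ω - m ω) P := hΔint.sub hm_int
  have hobs_int : Integrable (fun ω => (Yobs_t ω - Yobs_s ω) - m ω) P := (hYt.sub hYs).sub hm_int
  have hM_meas : AEStronglyMeasurable[𝔉] (M.indicator (fun _ => (1 : ℝ))) P :=
    ((hind hM).mono h𝒢).aestronglyMeasurable
  have hmovers : ∫ ω in M, (Yobs_t ω - Y0 t ω) ∂P =
      ∫ ω, M.indicator (fun _ => (1 : ℝ)) ω * ((Yobs_t ω - Yobs_s ω) - m ω) ∂P := by
    rw [← sub_zero (∫ ω, _ * _ ∂P), ← hresid (hind hM) (hbdd M),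
      ← integral_sub (hobs_int.bdd_mul hM_meas (hbdd M)) (hres_int.bdd_mul hM_meas (hbdd M)),
      ← integral_indicator (h𝒟 _ hM)]
    apply integral_congr_ae
    filter_upwards [hcons_s] with ω h₁
    by_cases hω : ω ∈ M
    · simp [hω, h₁ (Or.inl hω)]
    · simp [hω]
  set E := ∫ ω', gpsOdds P ℋ M S ω' * S.indicator (fun _ => (1 : ℝ)) ω' ∂P
  have hsplit : (fun ω => (M.indicator (fun _ => (1 : ℝ)) ω / (P M).toReal
        - gpsOdds P ℋ M S ω * S.indicator (fun _ => (1 : ℝ)) ω / E)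
          * ((Yobs_t ω - Yobs_s ω) - m ω)) =ᵐ[P]
      fun ω => M.indicator (fun _ => (1 : ℝ)) ω * ((Yobs_t ω - Yobs_s ω) - m ω) / (P M).toReal
        - gpsOdds P ℋ M S ω * S.indicator (fun _ => (1 : ℝ)) ω
          * ((Y0 t - Y0 s) ω - m ω) / E := by
    filter_upwards [hstayers] with ω hω
    simp only [Pi.mul_apply] at hω
    linear_combination (-(gpsOdds P ℋ M S ω / E)) * hω
  rw [integral_congr_ae hsplit,
    integral_sub ((hobs_int.bdd_mul hM_meas (hbdd M)).div_const _)
      ((hres_int.bdd_mul (hweight.mono h𝒢).aestronglyMeasurable hweight_bdd).div_const _),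
    integral_div, integral_div, hresid hweight hweight_bdd, zero_div, sub_zero, hmovers]
end
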